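/- arXiv:math/0610426 — 2 statements merged into one kernel-verified Lean document; each statement's English description precedes it below -/
import Mathlib

section
/- Let p be a prime number and let E/F be a finite Galois extension of fields of characteristic p with Galois group G = Gal(E/F), acting diagonally on E ⊗_{𝔽_p} E. Then the corestriction map cores_{E/F} : E ⊗_{𝔽_p} E → (E ⊗_{𝔽_p} E)^G determined by x ⊗ y ↦ Σ_{g ∈ G} g(x) ⊗ g(y) is surjective onto the subgroup of G-invariant elements. -/
open TensorProduct

/-- An element `g` of the Galois group `Gal(E/F)` of fields of characteristic `p`,
viewed as a `ZMod p = 𝔽_p`-linear automorphism-map of `E`. -/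
noncomputable def galLin (p : ℕ) (F E : Type) [Field F] [Field E] [Algebra F E]
    [Algebra (ZMod p) E] (g : E ≃ₐ[F] E) : E →ₗ[ZMod p] E :=
  AddMonoidHom.toZModLinearMap p g.toAlgHom.toRingHom.toAddMonoidHom

theorem galLin_apply (p : ℕ) (F E : Type) [Field F] [Field E] [Algebra F E]
    [Algebra (ZMod p) E] (g : E ≃ₐ[F] E) (x : E) : galLin p F E g x = g x :=
  rfl

theorem map_galLin_tmul_one_mul (p : ℕ) (F E : Type) [Field F] [Field E] [Algebra F E]
    [Algebra (ZMod p) E] (g : E ≃ₐ[F] E) (c : E) (z : E ⊗[ZMod p] E) :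
    TensorProduct.map (galLin p F E g) (galLin p F E g) (c ⊗ₜ[ZMod p] (1 : E) * z) =
      g c ⊗ₜ[ZMod p] (1 : E) * TensorProduct.map (galLin p F E g) (galLin p F E g) z := by
  induction z using TensorProduct.induction_on with
  | zero => simp
  | tmul x y => simp [galLin_apply]
  | add x y hx hy => rw [mul_add, map_add, hx, hy, map_add, mul_add]

/-- Let `p` be a prime number and let `E/F` be a finite Galois
extension of fields of characteristic `p` with Galois group `G = Gal(E/F)`, acting
diagonally on `E ⊗_{𝔽_p} E`.  Then the corestriction map
`cores_{E/F} : E ⊗_{𝔽_p} E → (E ⊗_{𝔽_p} E)^G`, `x ⊗ y ↦ Σ_{g ∈ G} g(x) ⊗ g(y)`, is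
surjective onto the subgroup of `G`-invariant elements. -/
theorem stmt10 (p : ℕ) [Fact p.Prime] (F E : Type) [Field F] [Field E] [Algebra F E]
    [CharP F p] [CharP E p] [Algebra (ZMod p) E]
    [IsGalois F E] [FiniteDimensional F E]
    (z : E ⊗[ZMod p] E)
    (hz : ∀ σ : E ≃ₐ[F] E,
      TensorProduct.map (galLin p F E σ) (galLin p F E σ) z = z) :
    ∃ w : E ⊗[ZMod p] E,
      (∑ σ : E ≃ₐ[F] E,
        TensorProduct.map (galLin p F E σ) (galLin p F E σ)) w = z := by
  obtain ⟨c, hc⟩ := Algebra.trace_surjective F E 1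
  have hsum : ∑ σ : E ≃ₐ[F] E, σ c = 1 := by
    rw [← trace_eq_sum_automorphisms, hc, map_one]
  refine ⟨c ⊗ₜ[ZMod p] (1 : E) * z, ?_⟩
  simp only [LinearMap.sum_apply, map_galLin_tmul_one_mul, hz]
  rw [← Finset.sum_mul, ← TensorProduct.sum_tmul, hsum, ← Algebra.TensorProduct.one_def,
    one_mul]
end

section
/- Let p be a prime number, O a local commutative integral domain with maximal ideal 𝔪, and ζ ∈ O a primitive p-th root of unity (an element of multiplicative order exactly p) with 1 − ζ ∈ 𝔪. If α, γ ∈ O satisfy (1 − (1 − ζ)γ)^p = 1 − (1 − ζ)^p α, then γ^p − γ − α ∈ 𝔪. -/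
/-- For `p` prime, all terms of the binomial expansion of `(1 + x) ^ p` other than `1`, `p * x` and
`x ^ p` are divisible by `p * x ^ 2`. -/
theorem Nat.Prime.exists_one_add_pow_eq {R : Type*} [CommRing R] {p : ℕ} (hp : p.Prime) (x : R) :
    ∃ s, (1 + x) ^ p = 1 + p * x + p * x ^ 2 * s + x ^ p := by
  obtain ⟨q, rfl⟩ := Nat.exists_eq_add_of_le' hp.two_le
  refine ⟨∑ i ∈ Finset.range q, x ^ i * (((q + 2).choose (i + 2) / (q + 2) : ℕ) : R), ?_⟩
  have key : ∀ i ∈ Finset.range q, x ^ (i + 2) * ((q + 2).choose (i + 2) : R) =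
      ((q + 2 : ℕ) : R) * x ^ 2 * (x ^ i * (((q + 2).choose (i + 2) / (q + 2) : ℕ) : R)) := by
    intro i hi
    have hdvd : q + 2 ∣ (q + 2).choose (i + 2) :=
      hp.dvd_choose_self (by omega) (by have := Finset.mem_range.1 hi; omega)
    have hc : ((q + 2).choose (i + 2) : R) =
        ((q + 2 : ℕ) : R) * (((q + 2).choose (i + 2) / (q + 2) : ℕ) : R) := by
      rw [← Nat.cast_mul, Nat.mul_div_cancel' hdvd]
    rw [hc]
    ring
  rw [add_comm 1 x, add_pow, Finset.sum_range_succ, Finset.sum_range_succ', Finset.sum_range_succ',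
    Finset.mul_sum, ← Finset.sum_congr rfl key]
  simp
  ring

/-- If `ζ` is a primitive `p`-th root of unity with `1 - ζ` in the maximal ideal, then
`p = (-1) ^ p * (1 - ζ) ^ (p - 1) * v` with `v` congruent to `1`. -/
theorem IsPrimitiveRoot.exists_prime_eq_one_sub_pow_mul {O : Type*} [CommRing O] [IsDomain O]
    [IsLocalRing O] {p : ℕ} (hp : p.Prime) {ζ : O} (hζ : IsPrimitiveRoot ζ p)
    (hζm : 1 - ζ ∈ IsLocalRing.maximalIdeal O) :
    ∃ v, (p : O) = (-1) ^ p * (1 - ζ) ^ (p - 1) * v ∧ v - 1 ∈ IsLocalRing.maximalIdeal O := by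
  have hne : 1 - ζ ≠ 0 := sub_ne_zero.2 (hζ.ne_one hp.one_lt).symm
  obtain ⟨t, ht⟩ := hp.exists_one_add_pow_eq (-(1 - ζ))
  have hpow : (1 - ζ) ^ p = (1 - ζ) * (1 - ζ) ^ (p - 1) :=
    (mul_pow_sub_one hp.ne_zero _).symm
  rw [neg_pow (1 - ζ) p, hpow, show 1 + -(1 - ζ) = ζ by ring, hζ.pow_eq_one] at ht
  have hp_mul : (p : O) * (1 - (1 - ζ) * t) = (-1) ^ p * (1 - ζ) ^ (p - 1) :=
    mul_left_cancel₀ hne (by linear_combination ht)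
  have hu : IsUnit (1 - (1 - ζ) * t) := by
    refine (IsLocalRing.isUnit_or_isUnit_one_sub_self ((1 - ζ) * t)).resolve_left ?_
    exact (IsLocalRing.mem_maximalIdeal _).1 (Ideal.mul_mem_right t _ hζm)
  obtain ⟨v, hv⟩ := hu.exists_right_inv
  refine ⟨v, by linear_combination v * hp_mul - (p : O) * hv, ?_⟩
  rw [show v - 1 = (1 - ζ) * (t * v) by linear_combination hv]
  exact Ideal.mul_mem_right _ _ hζm


/-- Let `p` be a prime number, `O` a local commutative integral domain
with maximal ideal `𝔪`, and `ζ ∈ O` a primitive `p`-th root of unity (an element of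
multiplicative order exactly `p`) with `1 − ζ ∈ 𝔪`.  If `α, γ ∈ O` satisfy
`(1 − (1 − ζ)γ)^p = 1 − (1 − ζ)^p α`, then `γ^p − γ − α ∈ 𝔪`. -/
theorem stmt13 (p : ℕ) (hp : p.Prime) (O : Type*) [CommRing O] [IsDomain O]
    [IsLocalRing O] (ζ : O) (hζ : IsPrimitiveRoot ζ p)
    (hζm : 1 - ζ ∈ IsLocalRing.maximalIdeal O) (α γ : O)
    (h : (1 - (1 - ζ) * γ) ^ p = 1 - (1 - ζ) ^ p * α) :
    γ ^ p - γ - α ∈ IsLocalRing.maximalIdeal O := by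
  have hne : 1 - ζ ≠ 0 := sub_ne_zero.2 (hζ.ne_one hp.one_lt).symm
  obtain ⟨v, hpv, hv⟩ := hζ.exists_prime_eq_one_sub_pow_mul hp hζm
  obtain ⟨s, hs⟩ := hp.exists_one_add_pow_eq (-((1 - ζ) * γ))
  have hpow : (1 - ζ) ^ p = (1 - ζ) * (1 - ζ) ^ (p - 1) :=
    (mul_pow_sub_one hp.ne_zero _).symm
  have hα : α = -(-1) ^ p * (γ ^ p - v * γ + v * (1 - ζ) * γ ^ 2 * s) := by
    refine mul_left_cancel₀ (pow_ne_zero p hne) ?_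
    rw [← sub_eq_add_neg, h, neg_pow ((1 - ζ) * γ) p, mul_pow, hpv, hpow] at hs
    rw [hpow]
    linear_combination -hs
  have hsign : (-1) ^ p + 1 ∈ IsLocalRing.maximalIdeal O := by
    rcases hp.eq_two_or_odd' with rfl | hodd
    · have h2 : (-1 : O) ^ 2 + 1 = (1 - ζ) * v := by
        push_cast at hpv
        linear_combination hpv
      rw [h2]
      exact Ideal.mul_mem_right _ _ hζm
    · simp [hodd.neg_one_pow]
  have hdecomp : γ ^ p - γ - α = (γ ^ p - v * γ) * ((-1) ^ p + 1) + γ * (v - 1) +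
      (-1) ^ p * v * γ ^ 2 * s * (1 - ζ) := by
    linear_combination -hα
  rw [hdecomp]
  exact add_mem (add_mem (Ideal.mul_mem_left _ _ hsign) (Ideal.mul_mem_left _ _ hv))
    (Ideal.mul_mem_left _ _ hζm)
end
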